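/- Let V be a finite type, ℓ : V → ℝ, G ⊆ V, and δ ≥ 0. Let p be the softmax of ℓ and p̂ the softmax of the watermarked logits ℓ̂(v) = ℓ(v) + δ·1(v ∈ G). Then for every order α > 1, the Rényi divergences in both directions are bounded: (1/(α−1))·log( ∑_{v∈V} p̂(v)^α · p(v)^{1−α} ) ≤ min(δ, α·δ²/8) and (1/(α−1))·log( ∑_{v∈V} p(v)^α · p̂(v)^{1−α} ) ≤ min(δ, α·δ²/8). -/

import Mathlib

open scoped BigOperators

/-- The softmax distribution associated to a vector of logits. -/
noncomputable def softmax {V : Type*} [Fintype V] (l : V → ℝ) (v : V) : ℝ :=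
  Real.exp (l v) / ∑ w, Real.exp (l w)

/-- The watermarked logits: add `δ` to the logits of the tokens in the green list `G`. -/
def wmLogits {V : Type*} [DecidableEq V] (l : V → ℝ) (G : Finset V) (δ : ℝ) (v : V) : ℝ :=
  l v + if v ∈ G then δ else 0

theorem softmax_pos {V : Type*} [Fintype V] [Nonempty V] (l : V → ℝ) (v : V) :
    0 < softmax l v :=
  div_pos (Real.exp_pos _) (Finset.sum_pos (fun _ _ => Real.exp_pos _) Finset.univ_nonempty)

theorem sum_softmax {V : Type*} [Fintype V] [Nonempty V] (l : V → ℝ) :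
    ∑ v, softmax l v = 1 := by
  have hZ : 0 < ∑ w, Real.exp (l w) :=
    Finset.sum_pos (fun _ _ => Real.exp_pos _) Finset.univ_nonempty
  simp only [softmax, ← Finset.sum_div]
  exact div_self hZ.ne'

/-- The moment generating function of the indicator of `G` under a distribution `p`. -/
theorem sum_mul_exp_indicator {V : Type*} [Fintype V] [DecidableEq V] {p : V → ℝ}
    (hp : ∑ v, p v = 1) (G : Finset V) (c : ℝ) :
    ∑ v, p v * Real.exp (if v ∈ G then c else 0) =
      1 - ∑ v ∈ G, p v + (∑ v ∈ G, p v) * Real.exp c := by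
  have hsplit := Finset.sum_add_sum_compl G p
  rw [← Finset.sum_add_sum_compl G, Finset.sum_mul,
    Finset.sum_congr rfl (fun v hv => by rw [if_pos hv]),
    Finset.sum_congr (s₁ := Gᶜ) rfl
      (fun v hv => by rw [if_neg (Finset.mem_compl.mp hv), Real.exp_zero, mul_one])]
  linarith

theorem softmax_wmLogits {V : Type*} [Fintype V] [Nonempty V] [DecidableEq V]
    (l : V → ℝ) (G : Finset V) (δ : ℝ) (v : V) :
    softmax (wmLogits l G δ) v = softmax l v * Real.exp (if v ∈ G then δ else 0) /
      (1 - ∑ w ∈ G, softmax l w + (∑ w ∈ G, softmax l w) * Real.exp δ) := by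
  have hZ : 0 < ∑ w, Real.exp (l w) :=
    Finset.sum_pos (fun _ _ => Real.exp_pos _) Finset.univ_nonempty
  rw [← sum_mul_exp_indicator (sum_softmax l) G δ]
  simp only [softmax, wmLogits, Real.exp_add, div_mul_eq_mul_div, ← Finset.sum_div]
  rw [div_div_div_cancel_right₀ hZ.ne']

theorem one_sub_add_mul_exp_pos {b : ℝ} (hb₀ : 0 ≤ b) (hb₁ : b ≤ 1) (u : ℝ) :
    0 < 1 - b + b * Real.exp u := by
  rcases hb₁.eq_or_lt with rfl | h
  · simpa using Real.exp_pos u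
  · have := mul_nonneg hb₀ (Real.exp_pos u).le
    linarith

/-- The Bernoulli cumulant generating function has second derivative at most `1 / 4`. -/
theorem concaveOn_log_bernoulli_mgf_sub_sq {b : ℝ} (hb₀ : 0 ≤ b) (hb₁ : b ≤ 1) :
    ConcaveOn ℝ Set.univ (fun u => Real.log (1 - b + b * Real.exp u) - u ^ 2 / 8) := by
  have hpos := one_sub_add_mul_exp_pos hb₀ hb₁
  have hM (u : ℝ) : HasDerivAt (fun u => 1 - b + b * Real.exp u) (b * Real.exp u) u :=
    ((Real.hasDerivAt_exp u).const_mul b).const_add (1 - b)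
  have h₁ (u : ℝ) : HasDerivAt (fun u => Real.log (1 - b + b * Real.exp u) - u ^ 2 / 8)
      (b * Real.exp u / (1 - b + b * Real.exp u) - u / 4) u := by
    refine (((hM u).log (hpos u).ne').sub ((hasDerivAt_pow 2 u).div_const 8)).congr_deriv ?_
    push_cast
    ring
  have h₂ (u : ℝ) : HasDerivAt (fun u => b * Real.exp u / (1 - b + b * Real.exp u) - u / 4)
      ((b * Real.exp u * (1 - b + b * Real.exp u) - b * Real.exp u * (b * Real.exp u)) /
        (1 - b + b * Real.exp u) ^ 2 - 1 / 4) u :=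
    (((Real.hasDerivAt_exp u).const_mul b).div (hM u) (hpos u).ne').sub
      ((hasDerivAt_id u).div_const 4)
  refine concaveOn_of_hasDerivWithinAt2_nonpos convex_univ
    (fun u _ => (h₁ u).continuousAt.continuousWithinAt)
    (fun u _ => (h₁ u).hasDerivWithinAt) (fun u _ => (h₂ u).hasDerivWithinAt) fun u _ => ?_
  rw [sub_nonpos, div_le_div_iff₀ (pow_pos (hpos u) 2) (by norm_num)]
  nlinarith [sq_nonneg (1 - b - b * Real.exp u)]

/-- The Rényi power sum in terms of the moment generating function of the indicator. -/
theorem sum_rpow_mul_rpow_watermark {V : Type*} [Fintype V] [Nonempty V] [DecidableEq V]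
    (l : V → ℝ) (G : Finset V) (δ s : ℝ) {b : ℝ} (hb : ∑ v ∈ G, softmax l v = b)
    (hM : 0 < 1 - b + b * Real.exp δ) :
    ∑ v, softmax (wmLogits l G δ) v ^ s * softmax l v ^ (1 - s) =
      (1 - b + b * Real.exp (s * δ)) / (1 - b + b * Real.exp δ) ^ s := by
  subst hb
  rw [← sum_mul_exp_indicator (sum_softmax l) G (s * δ), Finset.sum_div]
  refine Finset.sum_congr rfl fun v _ => ?_
  have hp := softmax_pos l v
  rw [softmax_wmLogits, Real.div_rpow (by positivity) hM.le,
    Real.mul_rpow hp.le (Real.exp_pos _).le, ← Real.exp_mul, Real.rpow_sub hp, Real.rpow_one,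
    ite_mul, zero_mul, mul_comm δ s]
  have := (Real.rpow_pos_of_pos hp s).ne'
  field_simp

theorem log_sum_rpow_mul_rpow_watermark {V : Type*} [Fintype V] [Nonempty V] [DecidableEq V]
    (l : V → ℝ) (G : Finset V) (δ s : ℝ) {b : ℝ} (hb : ∑ v ∈ G, softmax l v = b)
    (hb₀ : 0 ≤ b) (hb₁ : b ≤ 1) :
    Real.log (∑ v, softmax (wmLogits l G δ) v ^ s * softmax l v ^ (1 - s)) =
      Real.log (1 - b + b * Real.exp (s * δ)) - s * Real.log (1 - b + b * Real.exp δ) := by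
  have hpos := one_sub_add_mul_exp_pos hb₀ hb₁
  rw [sum_rpow_mul_rpow_watermark l G δ s hb (hpos δ),
    Real.log_div (hpos _).ne' (Real.rpow_pos_of_pos (hpos δ) s).ne', Real.log_rpow (hpos δ)]

/-- **Rényi-divergence bound for the watermarked token distribution.**  For every order
`α > 1`, the Rényi divergences of order `α` between the watermarked softmax
distribution `p̂` and the original softmax distribution `p`, in both directions, are
bounded by `min(δ, αδ²/8)`. -/
theorem watermark_renyi_bound {V : Type*} [Fintype V] [Nonempty V] [DecidableEq V]
    (l : V → ℝ) (G : Finset V) (δ : ℝ) (hδ : 0 ≤ δ) (α : ℝ) (hα : 1 < α) :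
    (1 / (α - 1) *
        Real.log (∑ v, softmax (wmLogits l G δ) v ^ α * softmax l v ^ (1 - α)) ≤
          min δ (α * δ ^ 2 / 8)) ∧
      (1 / (α - 1) *
        Real.log (∑ v, softmax l v ^ α * softmax (wmLogits l G δ) v ^ (1 - α)) ≤
          min δ (α * δ ^ 2 / 8)) := by
  set b := ∑ v ∈ G, softmax l v with hb
  have hb₀ : 0 ≤ b := Finset.sum_nonneg fun v _ => (softmax_pos l v).le
  have hb₁ : b ≤ 1 := (Finset.sum_le_univ_sum_of_nonneg fun v => (softmax_pos l v).le).trans_eq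
    (sum_softmax l)
  have hpos := one_sub_add_mul_exp_pos hb₀ hb₁
  have hconc := (concaveOn_log_bernoulli_mgf_sub_sq hb₀ hb₁).2
  have hα₀ : 0 < α := by linarith
  have hα₁ : 0 < α - 1 := by linarith
  have hK₀ : 0 ≤ Real.log (1 - b + b * Real.exp δ) :=
    Real.log_nonneg (by nlinarith [Real.one_le_exp hδ])
  have hK₁ : Real.log (1 - b + b * Real.exp δ) ≤ δ := by
    rw [Real.log_le_iff_le_exp (hpos δ)]
    nlinarith [Real.one_le_exp hδ]
  rw [one_div_mul_eq_div, one_div_mul_eq_div]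
  constructor
  · rw [log_sum_rpow_mul_rpow_watermark l G δ α hb.symm hb₀ hb₁, div_le_iff₀ hα₁,
      min_mul_of_nonneg _ _ hα₁.le]
    refine le_min ?_ ?_
    · have hK : Real.log (1 - b + b * Real.exp (α * δ)) ≤
          (α - 1) * δ + Real.log (1 - b + b * Real.exp δ) := by
        rw [← Real.log_exp ((α - 1) * δ), ← Real.log_mul (Real.exp_pos _).ne' (hpos δ).ne']
        refine Real.log_le_log (hpos _) ?_
        have hexp : Real.exp (α * δ) = Real.exp ((α - 1) * δ) * Real.exp δ := by
          rw [← Real.exp_add]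
          ring_nf
        rw [hexp]
        nlinarith [Real.one_le_exp (mul_nonneg hα₁.le hδ)]
      nlinarith [mul_nonneg hα₁.le hK₀]
    · have h := hconc (Set.mem_univ (α * δ)) (Set.mem_univ 0) (inv_pos.2 hα₀).le
        (sub_nonneg.2 (inv_le_one_of_one_le₀ hα.le)) (by ring)
      simp only [smul_eq_mul, mul_zero, add_zero, inv_mul_cancel_left₀ hα₀.ne', Real.exp_zero,
        mul_one, sub_add_cancel, Real.log_one] at h
      have h' := mul_le_mul_of_nonneg_left h hα₀.le
      norm_num [mul_inv_cancel_left₀ hα₀.ne'] at h'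
      linarith
  · have hsum : ∑ v, softmax l v ^ α * softmax (wmLogits l G δ) v ^ (1 - α) =
        ∑ v, softmax (wmLogits l G δ) v ^ (1 - α) * softmax l v ^ (1 - (1 - α)) := by
      simp only [sub_sub_cancel, mul_comm]
    rw [hsum, log_sum_rpow_mul_rpow_watermark l G δ (1 - α) hb.symm hb₀ hb₁, div_le_iff₀ hα₁,
      min_mul_of_nonneg _ _ hα₁.le]
    refine le_min ?_ ?_
    · have hK : Real.log (1 - b + b * Real.exp ((1 - α) * δ)) ≤ 0 := by
        refine Real.log_nonpos (hpos _).le ?_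
        have : Real.exp ((1 - α) * δ) ≤ 1 := Real.exp_le_one_iff.2 (by nlinarith)
        nlinarith
      nlinarith [mul_le_mul_of_nonneg_left hK₁ hα₁.le]
    · have h := hconc (Set.mem_univ ((1 - α) * δ)) (Set.mem_univ δ) (inv_pos.2 hα₀).le
        (sub_nonneg.2 (inv_le_one_of_one_le₀ hα.le)) (by ring)
      have hzero : α⁻¹ * ((1 - α) * δ) + (1 - α⁻¹) * δ = 0 := by
        field_simp
        ring
      simp only [smul_eq_mul, hzero, Real.exp_zero, mul_one, sub_add_cancel, Real.log_one] at h
      have h' := mul_le_mul_of_nonneg_left h hα₀.le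
      have hscale : α * (1 - α⁻¹) = α - 1 := by
        rw [mul_sub, mul_inv_cancel₀ hα₀.ne', mul_one]
      rw [mul_add, mul_inv_cancel_left₀ hα₀.ne', ← mul_assoc, hscale] at h'
      linarith
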